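/- Let n ≥ 2, set d = n−1, let 0 < u < 1 be real, and let φ : ℝ^d → ℂ be a Schwartz function. Then the function x ↦ |x|^{-d(1-u)} · ∫_{ℝ^d} conj(φ(y)) φ(y+x) dy is Lebesgue integrable on ℝ^d, the function ξ ↦ |ξ|^{-du} |𝓕φ(ξ)|² is Lebesgue integrable on ℝ^d, and ∫_{ℝ^d} ( ∫_{ℝ^d} conj(φ(y)) φ(y+x) dy ) |x|^{-d(1-u)} dx = π^{d(1-2u)/2} · (Γ(du/2) / Γ(d(1-u)/2)) · ∫_{ℝ^d} |𝓕φ(ξ)|² |ξ|^{-du} dξ. -/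

import Mathlib

open MeasureTheory Real
open scoped FourierTransform ComplexConjugate

section Aux

variable {V : Type*} [NormedAddCommGroup V] [InnerProductSpace ℝ V] [FiniteDimensional ℝ V]
  [MeasurableSpace V] [BorelSpace V] [Nontrivial V]

lemma aux_integrable (f : SchwartzMap V ℂ) {a : ℝ} (ha0 : 0 < a)
    (ha : a < Module.finrank ℝ V) :
    Integrable (fun x : V => f x * ((‖x‖ ^ (-a) : ℝ) : ℂ)) := by
  have hpos : 0 < Module.finrank ℝ V := Module.finrank_pos
  have hmeas : AEStronglyMeasurable (fun x : V => f x * ((‖x‖ ^ (-a) : ℝ) : ℂ)) volume := by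
    apply AEStronglyMeasurable.mul f.continuous.aestronglyMeasurable
    apply Measurable.aestronglyMeasurable
    fun_prop
  have hball : IntegrableOn (fun x : V => ‖x‖ ^ (-a)) (Metric.ball 0 1) := by
    rw [integrableOn_fun_norm_addHaar volume (f := fun y : ℝ => y ^ (-a))]
    have h1 : IntegrableOn (fun y : ℝ => y ^ ((Module.finrank ℝ V : ℝ) - 1 - a)) (Set.Ioo 0 1) := by
      rw [intervalIntegral.integrableOn_Ioo_rpow_iff one_pos]
      linarith
    refine h1.congr_fun ?_ measurableSet_Ioo
    intro y hy
    have hy0 : (0:ℝ) < y := hy.1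
    simp only [smul_eq_mul]
    rw [← Real.rpow_natCast, ← Real.rpow_add hy0, Nat.cast_sub hpos]
    congr 1
    push_cast; ring
  obtain ⟨C, hC⟩ : ∃ C, ∀ x, ‖f x‖ ≤ C := ⟨_, fun x => f.norm_le_seminorm ℝ x⟩
  rw [← integrableOn_univ, ← Set.union_compl_self (Metric.ball (0:V) 1)]
  apply IntegrableOn.union
  · refine Integrable.mono' (hball.const_mul C) hmeas.restrict ?_
    refine Filter.Eventually.of_forall fun x => ?_
    rw [norm_mul, Complex.norm_real, Real.norm_of_nonneg (by positivity)]
    exact mul_le_mul_of_nonneg_right (hC x) (by positivity)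
  · refine Integrable.mono' (f.integrable.norm.integrableOn) hmeas.restrict ?_
    refine (ae_restrict_iff' Metric.isOpen_ball.measurableSet.compl).2
      (Filter.Eventually.of_forall fun x hx => ?_)
    rw [norm_mul, Complex.norm_real, Real.norm_of_nonneg (by positivity)]
    have : 1 ≤ ‖x‖ := by simpa using hx
    have h2 : ‖x‖ ^ (-a) ≤ 1 := Real.rpow_le_one_of_one_le_of_nonpos this (by linarith)
    exact mul_le_of_le_one_right (norm_nonneg _) h2

lemma aux_gamma {a r : ℝ} (ha : 0 < a) (hr : 0 < r) :
    ∫ t in Set.Ioi (0:ℝ), t ^ (a / 2 - 1) * Real.exp (-(π * r ^ 2 * t)) =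
      π ^ (-(a / 2)) * Real.Gamma (a / 2) * r ^ (-a) := by
  rw [Real.integral_rpow_mul_exp_neg_mul_Ioi (by positivity) (by positivity), one_div,
    Real.inv_rpow (by positivity), ← Real.rpow_neg (by positivity),
    Real.mul_rpow (by positivity) (by positivity), ← Real.rpow_natCast r 2,
    ← Real.rpow_mul hr.le]
  have : ((2:ℕ):ℝ) * -(a/2) = -a := by push_cast; ring
  rw [this]; ring

lemma aux_gamma_int {a r : ℝ} (ha : 0 < a) (hr : 0 < r) :
    IntegrableOn (fun t : ℝ => t ^ (a / 2 - 1) * Real.exp (-(π * r ^ 2 * t))) (Set.Ioi 0) := by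
  by_contra h
  have h1 := aux_gamma ha hr
  rw [integral_undef h] at h1
  have : 0 < Real.Gamma (a/2) := Real.Gamma_pos_of_pos (by positivity)
  have : 0 < π ^ (-(a / 2)) * Real.Gamma (a / 2) * r ^ (-a) := by positivity
  linarith

lemma aux_fubini (f : SchwartzMap V ℂ) {a : ℝ} (ha0 : 0 < a)
    (ha : a < Module.finrank ℝ V) :
    ((π ^ (-(a / 2)) * Real.Gamma (a / 2) : ℝ) : ℂ) * ∫ x : V, f x * ((‖x‖ ^ (-a) : ℝ) : ℂ) =
    ∫ t in Set.Ioi (0:ℝ), ((t ^ (a / 2 - 1) : ℝ) : ℂ) *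
      ∫ x : V, f x * ((Real.exp (-(π * ‖x‖ ^ 2 * t)) : ℝ) : ℂ) := by
  have hne : ∀ᵐ x : V, x ≠ 0 := by
    simp [ae_iff]
  let F : V → ℝ → ℂ := fun x t =>
    f x * ((t ^ (a / 2 - 1) * Real.exp (-(π * ‖x‖ ^ 2 * t)) : ℝ) : ℂ)
  have hF : ∀ x : V, x ≠ 0 → ∫ t in Set.Ioi (0:ℝ), F x t =
      ((π ^ (-(a / 2)) * Real.Gamma (a / 2) : ℝ) : ℂ) * (f x * ((‖x‖ ^ (-a) : ℝ) : ℂ)) := by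
    intro x hx
    simp only [F]
    rw [integral_const_mul, integral_complex_ofReal, aux_gamma ha0 (norm_pos_iff.2 hx)]
    push_cast; ring
  have hFn : ∀ x : V, x ≠ 0 → ∫ t in Set.Ioi (0:ℝ), ‖F x t‖ =
      (π ^ (-(a / 2)) * Real.Gamma (a / 2)) * ‖f x * ((‖x‖ ^ (-a) : ℝ) : ℂ)‖ := by
    intro x hx
    rw [norm_mul, Complex.norm_real, Real.norm_of_nonneg (by positivity : 0 ≤ ‖x‖ ^ (-a))]
    have : ∫ t in Set.Ioi (0:ℝ), ‖F x t‖ = ∫ t in Set.Ioi (0:ℝ),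
        ‖f x‖ * (t ^ (a / 2 - 1) * Real.exp (-(π * ‖x‖ ^ 2 * t))) := by
      refine setIntegral_congr_fun measurableSet_Ioi fun t ht => ?_
      have ht : 0 < t := ht
      simp only [F]
      rw [norm_mul, Complex.norm_real, Real.norm_of_nonneg (by positivity)]
    rw [this, integral_const_mul, aux_gamma ha0 (norm_pos_iff.2 hx)]
    ring
  have hint : Integrable (Function.uncurry F)
      ((volume : Measure V).prod (volume.restrict (Set.Ioi (0:ℝ)))) := by
    have hm : AEStronglyMeasurable (Function.uncurry F)
      ((volume : Measure V).prod (volume.restrict (Set.Ioi (0:ℝ)))) := by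
      apply Measurable.aestronglyMeasurable
      have := f.continuous.measurable
      simp only [F, Function.uncurry_def]
      fun_prop
    rw [integrable_prod_iff hm]
    constructor
    · filter_upwards [hne] with x hx
      exact ((aux_gamma_int ha0 (norm_pos_iff.2 hx)).ofReal).const_mul (f x)
    · refine (((aux_integrable f ha0 ha).norm).const_mul
        (π ^ (-(a / 2)) * Real.Gamma (a / 2))).congr ?_
      filter_upwards [hne] with x hx
      exact (hFn x hx).symm
  have hsw := integral_integral_swap hint
  rw [← integral_const_mul]
  calc _ = ∫ x, ∫ t in Set.Ioi (0:ℝ), F x t := by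
        refine integral_congr_ae ?_
        filter_upwards [hne] with x hx
        exact (hF x hx).symm
    _ = _ := hsw
    _ = _ := by
        congr 1
        ext t
        rw [← integral_const_mul]
        congr 1
        ext x
        simp only [F]
        push_cast; ring

lemma aux_gauss (B : SchwartzMap V ℂ) {t : ℝ} (ht : 0 < t) :
    ∫ x : V, 𝓕 (⇑B) x * ((Real.exp (-(π * ‖x‖ ^ 2 * t)) : ℝ) : ℂ) =
      ((t ^ (-((Module.finrank ℝ V : ℝ) / 2)) : ℝ) : ℂ) *
      ∫ x : V, B x * ((Real.exp (-(π * ‖x‖ ^ 2 * t⁻¹)) : ℝ) : ℂ) := by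
  have hb : 0 < ((π * t : ℝ) : ℂ).re := by rw [Complex.ofReal_re]; positivity
  have hg : Integrable (fun v : V => Complex.exp (-((π * t : ℝ) : ℂ) * ‖v‖ ^ 2)) := by
    simpa using GaussianFourier.integrable_cexp_neg_mul_sq_norm_add hb 0 (0:V)
  have h := VectorFourier.integral_bilin_fourierIntegral_eq_flip (.mul ℂ ℂ) (L := innerₗ V)
    continuous_fourierChar continuous_inner (B.integrable (μ := volume)) hg
  have h' : ∫ x : V, 𝓕 (⇑B) x * Complex.exp (-((π * t : ℝ) : ℂ) * ‖x‖ ^ 2) =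
    ∫ x : V, B x * 𝓕 (fun v : V => Complex.exp (-((π * t : ℝ) : ℂ) * ‖v‖ ^ 2)) x := by
    simpa using! h
  rw [← integral_const_mul]
  convert h' using 1
  · congr 1; ext x; push_cast; ring_nf
  · congr 1; ext x
    rw [fourier_gaussian_innerProductSpace hb]
    have e1 : (π : ℂ) / ((π * t : ℝ) : ℂ) = ((t⁻¹ : ℝ) : ℂ) := by
      have : (π : ℂ) ≠ 0 := by exact_mod_cast Real.pi_ne_zero
      have : (t : ℂ) ≠ 0 := by exact_mod_cast ht.ne'
      push_cast; field_simp
    have e2 : -(π:ℂ) ^ 2 * ‖x‖ ^ 2 / ((π * t : ℝ) : ℂ) = ((-(π * ‖x‖ ^ 2 * t⁻¹) : ℝ) : ℂ) := by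
      have : (π : ℂ) ≠ 0 := by exact_mod_cast Real.pi_ne_zero
      have : (t : ℂ) ≠ 0 := by exact_mod_cast ht.ne'
      push_cast; field_simp
    have e3 : ((Module.finrank ℝ V : ℂ) / 2) = (((Module.finrank ℝ V : ℝ) / 2 : ℝ) : ℂ) := by
      push_cast; rfl
    rw [e1, e2, e3, ← Complex.ofReal_cpow (by positivity), ← Complex.ofReal_exp,
      Real.inv_rpow ht.le, Real.rpow_neg ht.le]
    ring

lemma aux_main (B A : SchwartzMap V ℂ) (hA : ⇑A = 𝓕 (⇑B)) {a b : ℝ} (ha0 : 0 < a) (hb0 : 0 < b)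
    (hab : a + b = Module.finrank ℝ V) :
    ((π ^ (-(a / 2)) * Real.Gamma (a / 2) : ℝ) : ℂ) * ∫ x : V, A x * ((‖x‖ ^ (-a) : ℝ) : ℂ) =
    ((π ^ (-(b / 2)) * Real.Gamma (b / 2) : ℝ) : ℂ) * ∫ x : V, B x * ((‖x‖ ^ (-b) : ℝ) : ℂ) := by
  rw [aux_fubini A ha0 (by linarith), aux_fubini B hb0 (by linarith), hA]
  symm
  rw [← integral_comp_rpow_Ioi _ (by norm_num : (-1:ℝ) ≠ 0)]
  refine setIntegral_congr_fun measurableSet_Ioi fun t ht => ?_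
  have ht : 0 < t := ht
  symm
  rw [aux_gauss B ht, Real.rpow_neg_one, ← mul_assoc, Complex.real_smul, ← mul_assoc]
  congr 1
  rw [← Complex.ofReal_mul, ← Complex.ofReal_mul]
  congr 1
  rw [Real.inv_rpow ht.le, ← Real.rpow_neg ht.le, ← Real.rpow_add ht, abs_neg, abs_one, one_mul,
    ← Real.rpow_add ht]
  congr 1
  rw [← hab]; ring

lemma aux_corr (φ : SchwartzMap V ℂ) (x : V) :
    ∫ y : V, conj (φ y) * φ (y + x) = 𝓕⁻ (fun ξ : V => conj (𝓕 (⇑φ) ξ) * 𝓕 (⇑φ) ξ) x := by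
  let ψ : SchwartzMap V ℂ := SchwartzMap.compSubConstCLM ℂ (-x) φ
  have h1 := SchwartzMap.integral_inner_fourier_fourier φ ψ
  have h2 : ∀ ξ, 𝓕 ψ ξ = 𝐞 (inner ℝ ξ x) • 𝓕 (⇑φ) ξ := by
    intro ξ
    have := congrFun (VectorFourier.fourierIntegral_comp_add_right 𝐞 volume (innerₗ V) (⇑φ) x) ξ
    have hψ : ⇑ψ = ⇑φ ∘ (fun v => v + x) := by ext v; simp [ψ]
    rw [SchwartzMap.fourier_coe, hψ, real_inner_comm]
    simpa using! this
  rw [Real.fourierInv_eq]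
  simp only [h2, SchwartzMap.fourier_coe, RCLike.inner_apply] at h1
  convert h1.symm using 1
  · congr 1; ext y; simp [ψ]; ring
  · congr 1; ext ξ; simp only [Circle.smul_def, smul_eq_mul]; ring

end Aux

/-- Theorem 3.2 of the paper (commutative model for the unramified complementary series of
`SO(n,1)`, with `d = n-1`), with the explicit constant for the 2π-normalized Fourier
transform. -/
theorem commutative_model (n : ℕ) (hn : 2 ≤ n) (u : ℝ) (hu0 : 0 < u) (hu1 : u < 1)
    (φ : SchwartzMap (EuclideanSpace ℝ (Fin (n - 1))) ℂ) :
    Integrable (fun x : EuclideanSpace ℝ (Fin (n - 1)) =>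
        (∫ y : EuclideanSpace ℝ (Fin (n - 1)), conj (φ y) * φ (y + x)) *
          (((‖x‖ ^ (-(((n : ℝ) - 1) * (1 - u)))) : ℝ) : ℂ)) ∧
    Integrable (fun ξ : EuclideanSpace ℝ (Fin (n - 1)) =>
        ‖𝓕 (⇑φ) ξ‖ ^ 2 * ‖ξ‖ ^ (-(((n : ℝ) - 1) * u))) ∧
    ∫ x : EuclideanSpace ℝ (Fin (n - 1)),
        (∫ y : EuclideanSpace ℝ (Fin (n - 1)), conj (φ y) * φ (y + x)) *
          (((‖x‖ ^ (-(((n : ℝ) - 1) * (1 - u)))) : ℝ) : ℂ)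
      = ((π ^ (((n : ℝ) - 1) * (1 - 2 * u) / 2) *
            (Real.Gamma (((n : ℝ) - 1) * u / 2) / Real.Gamma (((n : ℝ) - 1) * (1 - u) / 2)) *
            ∫ ξ : EuclideanSpace ℝ (Fin (n - 1)),
              ‖𝓕 (⇑φ) ξ‖ ^ 2 * ‖ξ‖ ^ (-(((n : ℝ) - 1) * u)) : ℝ) : ℂ) := by
  haveI : Nonempty (Fin (n - 1)) := ⟨⟨0, by omega⟩⟩
  have hn1 : (((n - 1 : ℕ) : ℝ)) = (n : ℝ) - 1 := by
    rw [Nat.cast_sub (by omega)]; simp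
  have hd : (0:ℝ) < (n : ℝ) - 1 := by
    have : (2:ℝ) ≤ n := by exact_mod_cast hn
    linarith
  have hfr : (Module.finrank ℝ (EuclideanSpace ℝ (Fin (n - 1))) : ℝ) = (n : ℝ) - 1 := by
    rw [finrank_euclideanSpace_fin, hn1]
  haveI : Nontrivial (EuclideanSpace ℝ (Fin (n - 1))) := by
    apply Module.nontrivial_of_finrank_pos (R := ℝ)
    rw [finrank_euclideanSpace_fin]; omega
  set a : ℝ := ((n : ℝ) - 1) * (1 - u) with ha
  set b : ℝ := ((n : ℝ) - 1) * u with hb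
  have ha0 : 0 < a := mul_pos hd (by linarith)
  have hb0 : 0 < b := mul_pos hd hu0
  have hab : a + b = Module.finrank ℝ (EuclideanSpace ℝ (Fin (n - 1))) := by
    rw [hfr, ha, hb]; ring
  let ψ : SchwartzMap (EuclideanSpace ℝ (Fin (n - 1))) ℂ := 𝓕 φ
  let B : SchwartzMap (EuclideanSpace ℝ (Fin (n - 1))) ℂ :=
    SchwartzMap.pairing (ContinuousLinearMap.mul ℝ ℂ)
      (SchwartzMap.postcompCLM (Complex.conjCLE : ℂ →L[ℝ] ℂ) ψ) ψ
  have hB : ⇑B = fun ξ => conj (𝓕 (⇑φ) ξ) * 𝓕 (⇑φ) ξ := by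
    ext ξ
    simp [B, ψ, SchwartzMap.pairing_apply_apply, SchwartzMap.fourier_coe]
  have hB2 : ∀ ξ, B ξ = ((‖𝓕 (⇑φ) ξ‖ ^ 2 : ℝ) : ℂ) := by
    intro ξ
    rw [hB]
    simp only
    rw [Complex.conj_mul']
    push_cast; rfl
  let A : SchwartzMap (EuclideanSpace ℝ (Fin (n - 1))) ℂ := 𝓕 B
  have hA : ⇑A = 𝓕 (⇑B) := SchwartzMap.fourier_coe B
  have hcorr : ∀ x : EuclideanSpace ℝ (Fin (n - 1)),
      ∫ y : EuclideanSpace ℝ (Fin (n - 1)), conj (φ y) * φ (y + x) = A (-x) := by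
    intro x
    rw [aux_corr, hA, ← hB, Real.fourierInv_eq_fourier_neg]
  have hIA := aux_integrable A ha0 (by linarith)
  have hIB := aux_integrable B hb0 (by linarith)
  have hmain := aux_main B A hA ha0 hb0 hab
  simp only [hcorr]
  have hBre : ∀ ξ, B ξ * ((‖ξ‖ ^ (-b) : ℝ) : ℂ) =
      ((‖𝓕 (⇑φ) ξ‖ ^ 2 * ‖ξ‖ ^ (-b) : ℝ) : ℂ) := by
    intro ξ; rw [hB2]; push_cast; rfl
  refine ⟨by simpa using hIA.comp_neg, ?_, ?_⟩
  · simp only [hBre] at hIB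
    exact Complex.reCLM.integrable_comp hIB
  · have h1 : ∫ x : EuclideanSpace ℝ (Fin (n - 1)), A (-x) * ((‖x‖ ^ (-a) : ℝ) : ℂ) =
        ∫ x : EuclideanSpace ℝ (Fin (n - 1)), A x * ((‖x‖ ^ (-a) : ℝ) : ℂ) := by
      rw [← integral_neg_eq_self (fun x : EuclideanSpace ℝ (Fin (n - 1)) =>
        A x * ((‖x‖ ^ (-a) : ℝ) : ℂ)) volume]
      simp only [norm_neg]
    rw [h1]
    simp only [hBre] at hmain
    rw [integral_complex_ofReal, ← Complex.ofReal_mul] at hmain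
    have hG : 0 < Real.Gamma (a / 2) := Real.Gamma_pos_of_pos (by positivity)
    have hc : 0 < π ^ (-(a / 2)) * Real.Gamma (a / 2) := by positivity
    have hc' : ((π ^ (-(a / 2)) * Real.Gamma (a / 2) : ℝ) : ℂ) ≠ 0 := by exact_mod_cast hc.ne'
    apply mul_left_cancel₀ hc'
    rw [hmain, ← Complex.ofReal_mul]
    congr 1
    have hexp : ((n : ℝ) - 1) * (1 - 2 * u) / 2 = a / 2 + -(b / 2) := by rw [ha, hb]; ring
    have hpi : π ^ (-(a / 2)) * π ^ (a / 2) = 1 := by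
      rw [← Real.rpow_add Real.pi_pos]; simp
    rw [hexp, Real.rpow_add Real.pi_pos]
    set I := ∫ ξ : EuclideanSpace ℝ (Fin (n - 1)), ‖𝓕 (⇑φ) ξ‖ ^ 2 * ‖ξ‖ ^ (-b)
    have hGG : Real.Gamma (a / 2) * (Real.Gamma (b / 2) / Real.Gamma (a / 2)) =
      Real.Gamma (b / 2) := by field_simp
    calc _ = 1 * π ^ (-(b / 2)) * Real.Gamma (b / 2) * I := by ring
      _ = (π ^ (-(a / 2)) * π ^ (a / 2)) * π ^ (-(b / 2)) *
          (Real.Gamma (a / 2) * (Real.Gamma (b / 2) / Real.Gamma (a / 2))) * I := by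
            rw [hpi, hGG]
      _ = _ := by ring
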